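/- Let G = (V,E) be a computation graph with work : V → ℝ≥0, size_out : V → ℝ≥0, B > 0, and k ≥ 1. Let (y, c) be any feasible point of the exact MIP: y : V × {0,…,k} → {0,1} monotone in b with y(v,0)=0, y(v,k)=1, y(u,b) ≥ y(v,b) for all (u,v) ∈ E and b; c : V × {1,…,k} → ℝ≥0 with c(u,b) ≥ y(u,b−1) + (y(v,b) − y(v,b−1)) − 1 and c(u,b) ≥ (y(u,b) − y(u,b−1)) − y(v,b) for all (u,v) ∈ E and b. Let f(v) be the least b with y(v,b) = 1. Then f is a DAG-respecting k-partition and the MIP objective max_b [ Σ_v work(v)·(y(v,b) − y(v,b−1)) + (1/B)·Σ_u size_out(u)·c(u,b) ] is at least the bottleneck cost of f, and hence at least OPT. -/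

import Mathlib

open Finset

attribute [local instance] Classical.propDecidable

/-- The edge relation of `E` is acyclic (no directed cycles), i.e. `G` is a DAG. -/
def IsAcyclicRel {V : Type*} (E : Finset (V × V)) : Prop :=
  ∀ v : V, ¬ Relation.TransGen (fun a b : V => (a, b) ∈ E) v v

/-- Total `work` of the nodes assigned to block `b` by the partition `f`. -/
noncomputable def blockWork {V : Type*} [Fintype V] (work : V → NNReal)
    (f : V → ℕ) (b : ℕ) : ℝ :=
  ∑ v ∈ Finset.univ.filter (fun v => f v = b), (work v : ℝ)

/-- Cut cost of block `b` under the partition `f`: `(1/B)` times the sum of `sizeOut u`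
over all nodes `u` having an edge `(u,v) ∈ E` with `f u < b = f v` or `f u = b < f v`,
each such `u` counted once. -/
noncomputable def cutCost {V : Type*} [Fintype V] (E : Finset (V × V)) (sizeOut : V → NNReal)
    (B : NNReal) (f : V → ℕ) (b : ℕ) : ℝ :=
  (1 / (B : ℝ)) * ∑ u ∈ Finset.univ.filter
      (fun u => ∃ v, (u, v) ∈ E ∧ ((f u < b ∧ f v = b) ∨ (f u = b ∧ b < f v))),
    (sizeOut u : ℝ)

/-- Cost of block `b` under `f`: work of the block plus its cut cost. -/
noncomputable def blockCost {V : Type*} [Fintype V] (E : Finset (V × V))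
    (work sizeOut : V → NNReal) (B : NNReal) (f : V → ℕ) (b : ℕ) : ℝ :=
  blockWork work f b + cutCost E sizeOut B f b

/-- Bottleneck cost of a `k`-partition `f`: the maximum block cost over blocks `1,…,k`. -/
noncomputable def bottleneck {V : Type*} [Fintype V] (E : Finset (V × V))
    (work sizeOut : V → NNReal) (B : NNReal) (k : ℕ) (hk : 1 ≤ k) (f : V → ℕ) : ℝ :=
  (Finset.Icc 1 k).sup' (Finset.nonempty_Icc.mpr hk) (blockCost E work sizeOut B f)

/-- The MTPP optimum: minimum bottleneck cost over all DAG-respecting `k`-partitions. -/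
noncomputable def OPT {V : Type*} [Fintype V] (E : Finset (V × V))
    (work sizeOut : V → NNReal) (B : NNReal) (k : ℕ) (hk : 1 ≤ k) : ℝ :=
  sInf {r : ℝ | ∃ f : V → ℕ, (∀ v, f v ∈ Finset.Icc 1 k) ∧ (∀ e ∈ E, f e.1 ≤ f e.2) ∧
    bottleneck E work sizeOut B k hk f = r}

/-- The simple combinatorial lower bound
`L = max(max_v work v, (1/k) Σ_v work v)`. -/
noncomputable def simpleLB {V : Type*} [Fintype V] [Nonempty V]
    (work : V → NNReal) (k : ℕ) : ℝ :=
  max (Finset.univ.sup' Finset.univ_nonempty (fun v => (work v : ℝ)))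
      ((∑ v, (work v : ℝ)) / k)

/-- Aggregated cost of the superblock `S`: total work of the nodes assigned to blocks in `S`
plus `(1/B)` times the sum of `sizeOut u` over nodes `u` having an edge `(u,v) ∈ E` with
exactly one of `f u`, `f v` in `S` (each such `u` counted once). -/
noncomputable def aggCost {V : Type*} [Fintype V] (E : Finset (V × V))
    (work sizeOut : V → NNReal) (B : NNReal) (f : V → ℕ) (S : Finset ℕ) : ℝ :=
  (∑ v ∈ Finset.univ.filter (fun v => f v ∈ S), (work v : ℝ)) +
  (1 / (B : ℝ)) * ∑ u ∈ Finset.univ.filter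
      (fun u => ∃ v, (u, v) ∈ E ∧ ((f u ∈ S ∧ f v ∉ S) ∨ (f u ∉ S ∧ f v ∈ S))),
    (sizeOut u : ℝ)

/-- The constraints of the exact MIP of Figure 2: `y` is binary and monotone in the block
index with boundary conditions `y v 0 = 0`, `y v k = 1`; the DAG constraints
`y u b ≥ y v b` for edges `(u,v)`; and `c` is nonnegative and satisfies the two tensor
edge-cut constraints (with `x v b = y v b − y v (b−1)` substituted away). -/
def MIPFeasible {V : Type*} [Fintype V] (E : Finset (V × V)) (k : ℕ)
    (y : V → ℕ → ℝ) (c : V → ℕ → ℝ) : Prop :=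
  (∀ v : V, ∀ b ≤ k, y v b = 0 ∨ y v b = 1) ∧
  (∀ v : V, y v 0 = 0) ∧ (∀ v : V, y v k = 1) ∧
  (∀ v : V, ∀ b, 1 ≤ b → b ≤ k → y v (b - 1) ≤ y v b) ∧
  (∀ e ∈ E, ∀ b, 1 ≤ b → b ≤ k → y e.2 b ≤ y e.1 b) ∧
  (∀ (u : V) (b : ℕ), 0 ≤ c u b) ∧
  (∀ e ∈ E, ∀ b, 1 ≤ b → b ≤ k →
    y e.1 (b - 1) + (y e.2 b - y e.2 (b - 1)) - 1 ≤ c e.1 b) ∧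
  (∀ e ∈ E, ∀ b, 1 ≤ b → b ≤ k →
    (y e.1 b - y e.1 (b - 1)) - y e.2 b ≤ c e.1 b)

/-- The objective of the exact MIP: the maximum over blocks `b ∈ {1,…,k}` of
`Σ_v work v · (y v b − y v (b−1)) + (1/B) Σ_u sizeOut u · c u b`. -/
noncomputable def MIPObjective {V : Type*} [Fintype V] (work sizeOut : V → NNReal)
    (B : NNReal) (k : ℕ) (hk : 1 ≤ k) (y : V → ℕ → ℝ) (c : V → ℕ → ℝ) : ℝ :=
  (Finset.Icc 1 k).sup' (Finset.nonempty_Icc.mpr hk)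
    (fun b => (∑ v, (work v : ℝ) * (y v b - y v (b - 1))) +
      (1 / (B : ℝ)) * ∑ u, (sizeOut u : ℝ) * c u b)

theorem blockCost_nonneg {V : Type*} [Fintype V] (E : Finset (V × V))
    (work sizeOut : V → NNReal) (B : NNReal) (f : V → ℕ) (b : ℕ) :
    0 ≤ blockCost E work sizeOut B f b := by
  unfold blockCost blockWork cutCost
  positivity

theorem bottleneck_nonneg {V : Type*} [Fintype V] (E : Finset (V × V))
    (work sizeOut : V → NNReal) (B : NNReal) (k : ℕ) (hk : 1 ≤ k) (f : V → ℕ) :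
    0 ≤ bottleneck E work sizeOut B k hk f :=
  (blockCost_nonneg E work sizeOut B f 1).trans
    (Finset.le_sup' (blockCost E work sizeOut B f) (Finset.mem_Icc.mpr ⟨le_rfl, hk⟩))

theorem OPT_le_bottleneck {V : Type*} [Fintype V] (E : Finset (V × V))
    (work sizeOut : V → NNReal) (B : NNReal) (k : ℕ) (hk : 1 ≤ k) (f : V → ℕ)
    (hmem : ∀ v, f v ∈ Finset.Icc 1 k) (hmono : ∀ e ∈ E, f e.1 ≤ f e.2) :
    OPT E work sizeOut B k hk ≤ bottleneck E work sizeOut B k hk f := by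
  refine csInf_le ⟨0, ?_⟩ ⟨f, hmem, hmono, rfl⟩
  rintro _ ⟨g, -, -, rfl⟩
  exact bottleneck_nonneg E work sizeOut B k hk g

/-- A monotone 0/1 sequence on `{0,…,k}` reaching `1` is the indicator of `{b | m ≤ b}`,
where `m` is the first index at which it takes the value `1`. -/
theorem eq_ite_sInf_le {k : ℕ} {z : ℕ → ℝ} (hbin : ∀ b ≤ k, z b = 0 ∨ z b = 1)
    (hk : z k = 1) (hmono : ∀ b, 1 ≤ b → b ≤ k → z (b - 1) ≤ z b) {b : ℕ} (hb : b ≤ k) :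
    z b = if sInf {b | z b = 1} ≤ b then 1 else 0 := by
  have hfirst : z (sInf {b | z b = 1}) = 1 := Nat.sInf_mem (s := {b | z b = 1}) ⟨k, hk⟩
  split_ifs with h
  · induction b, h using Nat.le_induction with
    | base => exact hfirst
    | succ n _ ih =>
      have hstep : z n ≤ z (n + 1) := hmono (n + 1) (Nat.le_add_left 1 n) hb
      rw [ih (Nat.le_of_succ_le hb)] at hstep
      rcases hbin (n + 1) hb with h0 | h1
      · linarith
      · exact h1
  · exact (hbin b hb).resolve_right fun h1 => h (Nat.sInf_le h1)

/-- In each block, the cost of the induced partition is at most the corresponding term of the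
MIP objective. -/
theorem blockCost_le_of_indicator {V : Type*} [Fintype V] {E : Finset (V × V)}
    (work sizeOut : V → NNReal) (B : NNReal) {k : ℕ} {y c : V → ℕ → ℝ}
    (hfeas : MIPFeasible E k y c) {f : V → ℕ}
    (hy : ∀ v, ∀ b ≤ k, y v b = if f v ≤ b then 1 else 0) {b : ℕ} (hb1 : 1 ≤ b) (hbk : b ≤ k) :
    blockCost E work sizeOut B f b ≤
      (∑ v, (work v : ℝ) * (y v b - y v (b - 1))) +
        (1 / (B : ℝ)) * ∑ u, (sizeOut u : ℝ) * c u b := by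
  obtain ⟨-, -, -, -, -, hc0, hc1, hc2⟩ := hfeas
  have hb' : b - 1 ≤ k := (Nat.sub_le b 1).trans hbk
  refine add_le_add (le_of_eq ?_) (mul_le_mul_of_nonneg_left ?_ (by positivity))
  · rw [blockWork, Finset.sum_filter]
    refine Finset.sum_congr rfl fun v _ => ?_
    rw [hy v b hbk, hy v (b - 1) hb']
    rcases lt_trichotomy (f v) b with h | h | h
    · simp [h.ne, h.le, Nat.le_sub_one_of_lt h]
    · simp [h, show ¬ b ≤ b - 1 by omega]
    · simp [h.ne', show ¬ f v ≤ b by omega, show ¬ f v ≤ b - 1 by omega]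
  · rw [Finset.sum_filter]
    refine Finset.sum_le_sum fun u _ => ?_
    split_ifs with h
    · refine le_mul_of_one_le_right (sizeOut u).coe_nonneg ?_
      obtain ⟨v, huv, ⟨hu, hv⟩ | ⟨hu, hv⟩⟩ := h
      · have h1 := hc1 (u, v) huv b hb1 hbk
        rw [hy u (b - 1) hb', hy v b hbk, hy v (b - 1) hb', if_pos (by omega),
          if_pos (by omega), if_neg (by omega)] at h1
        linarith
      · have h2 := hc2 (u, v) huv b hb1 hbk
        rw [hy u b hbk, hy u (b - 1) hb', hy v b hbk, if_pos (by omega),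
          if_neg (by omega), if_neg (by omega)] at h2
        linarith
    · exact mul_nonneg (sizeOut u).coe_nonneg (hc0 u b)

/-- other direction of Theorem 3.1: any feasible point `(y, c)` of the
exact MIP induces, via `f v = min{b : y v b = 1}`, a DAG-respecting `k`-partition whose
bottleneck cost is at most the MIP objective of `(y, c)`; hence the MIP objective is at
least `OPT`. -/
theorem stmt12 {V : Type*} [Fintype V] (E : Finset (V × V)) (hacyc : IsAcyclicRel E)
    (work sizeOut : V → NNReal) (B : NNReal) (hB : 0 < B) (k : ℕ) (hk : 1 ≤ k)
    (y : V → ℕ → ℝ) (c : V → ℕ → ℝ) (hfeas : MIPFeasible E k y c)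
    (f : V → ℕ) (hf : ∀ v, f v = sInf {b | y v b = 1}) :
    (∀ v, f v ∈ Finset.Icc 1 k) ∧ (∀ e ∈ E, f e.1 ≤ f e.2) ∧
    bottleneck E work sizeOut B k hk f ≤ MIPObjective work sizeOut B k hk y c ∧
    OPT E work sizeOut B k hk ≤ MIPObjective work sizeOut B k hk y c := by
  have hy : ∀ v, ∀ b ≤ k, y v b = if f v ≤ b then 1 else 0 := fun v b hb => by
    rw [hf v]
    exact eq_ite_sInf_le (hfeas.1 v) (hfeas.2.2.1 v) (hfeas.2.2.2.1 v) hb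
  have hfirst : ∀ v, y v (f v) = 1 := fun v => by
    rw [hf v]
    exact Nat.sInf_mem (s := {b | y v b = 1}) ⟨k, hfeas.2.2.1 v⟩
  have hfk : ∀ v, f v ≤ k := fun v => by
    rw [hf v]
    exact Nat.sInf_le (hfeas.2.2.1 v)
  have hf1 : ∀ v, 1 ≤ f v := fun v => by
    refine Nat.one_le_iff_ne_zero.mpr fun h => ?_
    have h1 := hfirst v
    rw [h, hfeas.2.1 v] at h1
    exact zero_ne_one h1
  have hmem : ∀ v, f v ∈ Finset.Icc 1 k := fun v => Finset.mem_Icc.mpr ⟨hf1 v, hfk v⟩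
  have hmono : ∀ e ∈ E, f e.1 ≤ f e.2 := fun e he => by
    have h := hfeas.2.2.2.2.1 e he (f e.2) (hf1 e.2) (hfk e.2)
    rw [hfirst e.2, hy e.1 (f e.2) (hfk e.2)] at h
    by_contra hlt
    rw [if_neg hlt] at h
    exact absurd h (by norm_num)
  have hle : bottleneck E work sizeOut B k hk f ≤ MIPObjective work sizeOut B k hk y c := by
    refine Finset.sup'_mono_fun fun b hb => ?_
    obtain ⟨hb1, hbk⟩ := Finset.mem_Icc.mp hb
    exact blockCost_le_of_indicator work sizeOut B hfeas hy hb1 hbk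
  exact ⟨hmem, hmono, hle, (OPT_le_bottleneck E work sizeOut B k hk f hmem hmono).trans hle⟩
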